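/- For every 0 ≤ i ≤ σ, one has B_{δ−i} = x_n^{δ−2i}·B_i. -/

import Mathlib

open MvPolynomial

/-- The total degree of an exponent vector. -/
def expDeg {n : ℕ} (μ : Fin n →₀ ℕ) : ℕ := μ.sum fun _ e => e

/-- Strict degree reverse lexicographic order on exponent vectors, for variables
`x_1 > ⋯ > x_n` (indexed by `Fin n` in this order). -/
def DrlLT {n : ℕ} (a b : Fin n →₀ ℕ) : Prop :=
  expDeg a < expDeg b ∨
    (expDeg a = expDeg b ∧ ∃ i : Fin n, b i < a i ∧ ∀ j : Fin n, i < j → a j = b j)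

/-- `μ` is the leading (degrevlex-largest) exponent of `p`. -/
def IsLeadExp {n : ℕ} {K : Type*} [CommSemiring K] (p : MvPolynomial (Fin n) K)
    (μ : Fin n →₀ ℕ) : Prop :=
  μ ∈ p.support ∧ ∀ ν ∈ p.support, ν ≠ μ → DrlLT ν μ

/-- The initial ideal of `I` with respect to the degree reverse lexicographic order. -/
noncomputable def initialIdeal {n : ℕ} {K : Type*} [CommRing K]
    (I : Ideal (MvPolynomial (Fin n) K)) : Ideal (MvPolynomial (Fin n) K) :=
  Ideal.span { m | ∃ p ∈ I, p ≠ 0 ∧ ∃ μ, IsLeadExp p μ ∧ m = monomial μ (1 : K) }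

/-- The standard monomials of degree `i` of `I` : exponents of the monomials of degree `i`
not lying in the initial ideal of `I`. -/
def stdMon {n : ℕ} {K : Type*} [CommRing K] (I : Ideal (MvPolynomial (Fin n) K)) (i : ℕ) :
    Set (Fin n →₀ ℕ) :=
  { μ | expDeg μ = i ∧ monomial μ (1 : K) ∉ initialIdeal I }

/-- `μ` is a minimal monomial generator of the monomial ideal `M`. -/
def IsMinGen {n : ℕ} {K : Type*} [CommRing K] (M : Ideal (MvPolynomial (Fin n) K))
    (μ : Fin n →₀ ℕ) : Prop :=
  monomial μ (1 : K) ∈ M ∧ ∀ ν : Fin n →₀ ℕ, ν ≤ μ → ν ≠ μ → monomial ν (1 : K) ∉ M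

/-- `μ` satisfies property `P` with respect to the monomial ideal `M`: if `m` is the largest
index of a variable dividing `x^μ`, then every monomial of the same degree in the variables of
index `< m` also lies in `M`. -/
def SatisfiesP {n : ℕ} {K : Type*} [CommRing K] (M : Ideal (MvPolynomial (Fin n) K))
    (μ : Fin n →₀ ℕ) : Prop :=
  ∀ m : Fin n, μ m ≠ 0 → (∀ j : Fin n, m < j → μ j = 0) →
    ∀ ν : Fin n →₀ ℕ, expDeg ν = expDeg μ → (∀ j : Fin n, m ≤ j → ν j = 0) →
      monomial ν (1 : K) ∈ M

/-- Conjecture E (Pardue) holds for the ideal `I`: every minimal generator of the initial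
ideal of `I` satisfies property `P`. -/
def ConjE {n : ℕ} {K : Type*} [CommRing K] (I : Ideal (MvPolynomial (Fin n) K)) : Prop :=
  ∀ μ, IsMinGen (initialIdeal I) μ → SatisfiesP (initialIdeal I) μ

/-- `f` is a generic sequence of forms of degrees `d i` over the base field `F`: each `f i` is
homogeneous of degree `d i` and the family of all coefficients (at all monomials of degree
`d i`) is algebraically independent over `F`. -/
def IsGenericSeq (F : Type*) {K : Type*} [CommRing F] [CommRing K] [Algebra F K]
    {n r : ℕ} (d : Fin r → ℕ) (f : Fin r → MvPolynomial (Fin n) K) : Prop :=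
  (∀ i, (f i).IsHomogeneous (d i)) ∧
    AlgebraicIndependent F
      (fun p : Σ i : Fin r, { μ : Fin n →₀ ℕ // expDeg μ = d i } => (f p.1).coeff p.2.1)

/-- The projection `K[x_1,…,x_n,z] → K[x_1,…,x_n]` sending `z` (the last variable) to `0` and
fixing the other variables. -/
noncomputable def projMap (K : Type*) [CommRing K] (n : ℕ) :
    MvPolynomial (Fin (n + 1)) K →ₐ[K] MvPolynomial (Fin n) K :=
  aeval (fun i => Fin.lastCases 0 (fun j => X j) i)

/-- Embedding of exponent vectors of `K[x_1,…,x_n]` into those of `K[x_1,…,x_n,z]`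
(`z`-exponent `0`). -/
noncomputable def embExp {n : ℕ} (μ : Fin n →₀ ℕ) : Fin (n + 1) →₀ ℕ :=
  Finsupp.embDomain ⟨Fin.castSucc, Fin.castSucc_injective n⟩ μ

/-- Multiplication by `z^c` on exponent vectors in `K[x_1,…,x_n,z]`. -/
noncomputable def zShift {n : ℕ} (c : ℕ) (μ : Fin (n + 1) →₀ ℕ) : Fin (n + 1) →₀ ℕ :=
  μ + Finsupp.single (Fin.last n) c

/-- `f` (homogeneous of degree `e`) is semi-regular on `R/I`: in each degree `t`, the
multiplication map `(R/I)_t → (R/I)_{t+e}` is injective or surjective. -/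
def SemiRegularOn {vars K : Type*} [CommRing K] (I : Ideal (MvPolynomial vars K))
    (f : MvPolynomial vars K) (e : ℕ) : Prop :=
  ∀ t : ℕ,
    (∀ p ∈ homogeneousSubmodule vars K t, f * p ∈ I → p ∈ I) ∨
    (∀ q ∈ homogeneousSubmodule vars K (t + e),
      ∃ p ∈ homogeneousSubmodule vars K t, q - f * p ∈ I)

/-- The degree-`t` graded piece of `R/I`, as a `K`-submodule of the quotient. -/
noncomputable def quotDegPart {vars K : Type*} [CommRing K] (I : Ideal (MvPolynomial vars K))
    (t : ℕ) : Submodule K (MvPolynomial vars K ⧸ I) :=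
  (homogeneousSubmodule vars K t).map (Ideal.Quotient.mkₐ K I).toLinearMap

/-- Finitely many linearly independent functions have a nonvanishing maximal minor. -/
theorem exists_det_ne_zero_of_linearIndependent {K ρ κ : Type*} [Field K] [Fintype ρ]
    [DecidableEq ρ] (v : ρ → κ → K) (hv : LinearIndependent K v) :
    ∃ e : ρ → κ, (Matrix.of fun i j => v i (e j)).det ≠ 0 := by
  let col : κ → ρ → K := fun k i => v i k
  have hspan : Submodule.span K (Set.range col) = ⊤ := by
    by_contra hne
    obtain ⟨φ, hφ0, hφ⟩ := Submodule.exists_le_ker_of_lt_top _ (lt_top_iff_ne_top.2 hne)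
    apply hφ0
    have hzero : ∀ i, φ (Pi.single i 1) = 0 := by
      refine Fintype.linearIndependent_iff.1 hv (fun i => φ (Pi.single i 1)) ?_
      funext k
      have hk : φ (col k) = 0 := hφ (Submodule.subset_span ⟨k, rfl⟩)
      rw [← Finset.univ_sum_single (col k), map_sum] at hk
      rw [Finset.sum_apply, Pi.zero_apply, ← hk]
      refine Finset.sum_congr rfl fun i _ => ?_
      have : (Pi.single i (col k i) : ρ → K) = col k i • Pi.single i 1 := by
        rw [← Pi.single_smul, smul_eq_mul, mul_one]
      rw [this, map_smul, Pi.smul_apply, smul_eq_mul, smul_eq_mul, mul_comm]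
    refine LinearMap.pi_ext' fun i => LinearMap.ext_ring ?_
    simpa using hzero i
  obtain ⟨ι, a, -, hspan', hli⟩ := exists_linearIndependent' K col
  let b := Module.Basis.mk hli (by rw [hspan', hspan])
  let σ : ρ ≃ ι := (Pi.basisFun K ρ).indexEquiv b
  refine ⟨a ∘ σ, ?_⟩
  have hli' : LinearIndependent K fun j : ρ => col (a (σ j)) :=
    hli.comp σ σ.injective
  have hu : IsUnit (Matrix.of fun j i => col (a (σ j)) i) :=
    Matrix.linearIndependent_rows_iff_isUnit.1 hli'
  rw [Matrix.isUnit_iff_isUnit_det, ← Matrix.det_transpose] at hu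
  exact hu.ne_zero

/-- Linear independence at one parameter value implies linear independence at a generic one. -/
theorem linearIndependent_of_specialization {F K ι ρ κ : Type*} [Field F] [Field K] [Algebra F K]
    [Finite ρ] {g : ι → K} (hg : AlgebraicIndependent F g) (c : ι → K)
    (w : ρ → κ → MvPolynomial ι F)
    (hc : LinearIndependent K fun i k => aeval c (w i k)) :
    LinearIndependent K fun i k => aeval g (w i k) := by
  classical
  cases nonempty_fintype ρ
  obtain ⟨e, he⟩ := exists_det_ne_zero_of_linearIndependent _ hc
  let D := Matrix.det (Matrix.of fun i j => w i (e j))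
  have hD : ∀ x : ι → K, aeval x D = (Matrix.of fun i j => aeval x (w i (e j))).det := fun x => by
    rw [AlgHom.map_det]; rfl
  have hD0 : D ≠ 0 := fun h => he (by rw [← hD c, h, map_zero])
  have hgD : (Matrix.of fun i j => aeval g (w i (e j))).det ≠ 0 := by
    rw [← hD g]
    exact fun h => hD0 (hg (by rw [h, map_zero]))
  refine LinearIndependent.of_comp (LinearMap.funLeft K K e) ?_
  exact Matrix.linearIndependent_rows_of_det_ne_zero hgD

/-- The rank of a finite family depending polynomially on parameters is largest at a generic
parameter value. -/
theorem finrank_span_le_of_specialization {F K ι ρ κ : Type*} [Field F] [Field K] [Algebra F K]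
    [Finite ρ] {g : ι → K} (hg : AlgebraicIndependent F g) (c : ι → K)
    (w : ρ → κ → MvPolynomial ι F) :
    Module.finrank K (Submodule.span K (Set.range fun i k => aeval c (w i k))) ≤
      Module.finrank K (Submodule.span K (Set.range fun i k => aeval g (w i k))) := by
  obtain ⟨τ, a, ha, hspan, hli⟩ := exists_linearIndependent' K fun i k => aeval c (w i k)
  have : Finite τ := Finite.of_injective a ha
  cases nonempty_fintype τ
  have hli' := linearIndependent_of_specialization hg c (fun i => w (a i)) hli
  rw [← hspan, finrank_span_eq_card hli, ← finrank_span_eq_card hli']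
  have : FiniteDimensional K (Submodule.span K (Set.range fun i k => aeval g (w i k))) :=
    FiniteDimensional.span_of_finite K (Set.finite_range _)
  refine Submodule.finrank_mono (Submodule.span_mono ?_)
  rintro _ ⟨i, rfl⟩
  exact ⟨a i, rfl⟩

theorem span_eq_top_of_specialization {F K ι ρ κ : Type*} [Field F] [Field K] [Algebra F K]
    [Finite ρ] [Finite κ] {g : ι → K} (hg : AlgebraicIndependent F g) (c : ι → K)
    (w : ρ → κ → MvPolynomial ι F)
    (hc : Submodule.span K (Set.range fun i k => aeval c (w i k)) = ⊤) :
    Submodule.span K (Set.range fun i k => aeval g (w i k)) = ⊤ := by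
  refine Submodule.eq_top_of_finrank_eq (le_antisymm (Submodule.finrank_le _) ?_)
  have := finrank_span_le_of_specialization hg c w
  rwa [hc, finrank_top] at this

/-- The part of degree `N` of the ideal `(ℓ^q, g, z^k)` of the algebra of binary forms in `ℓ, z`,
where `g` has degree `d`. -/
def binarySpan (K : Type*) {R : Type*} [Field K] [CommRing R] [Algebra K R] (ℓ z g : R)
    (q d k N : ℕ) : Submodule K R :=
  Submodule.span K {x | ∃ u v : ℕ, (q + u + v = N ∧ x = ℓ ^ q * (ℓ ^ u * z ^ v)) ∨
    (d + u + v = N ∧ x = g * (ℓ ^ u * z ^ v)) ∨ (k + u + v = N ∧ x = z ^ k * (ℓ ^ u * z ^ v))}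

/-- For a generic binary form `g` of degree `d`, the ideal `(ℓ^q, g, z^k)` contains all forms of
degree `N` as soon as this is compatible with a dimension count. -/
theorem mem_binarySpan_of_generic {F K R : Type*} [Field F] [Field K] [Algebra F K]
    [CommRing R] [Algebra K R] {d : ℕ} {c : Fin (d + 1) → K} (hc : AlgebraicIndependent F c)
    (ℓ z : R) {q k N a b : ℕ} (hN : q + d + k = 2 * N + 2) (hab : a + b = N) :
    ℓ ^ a * z ^ b ∈
      binarySpan K ℓ z (∑ j : Fin (d + 1), c j • (ℓ ^ (j : ℕ) * z ^ (d - j))) q d k N := by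
  classical
  set g := ∑ j : Fin (d + 1), c j • (ℓ ^ (j : ℕ) * z ^ (d - j)) with hg
  let w : (Fin (N + 1) ⊕ Fin (N + 1) ⊕ Fin (N + 1)) → Fin (N + 1) →
      MvPolynomial (Fin (d + 1)) F := fun s x => match s with
    | .inl y => if q ≤ (y : ℕ) ∧ x = y then 1 else 0
    | .inr (.inl y) => if k + (y : ℕ) ≤ N ∧ x = y then 1 else 0
    | .inr (.inr u) => if h : (u : ℕ) + d ≤ N ∧ (u : ℕ) ≤ x ∧ (x : ℕ) < u + d + 1 then
        X ⟨(x : ℕ) - u, by omega⟩ else 0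
  have htop : Submodule.span K (Set.range fun s x => aeval c (w s x)) = ⊤ := by
    let c₀ : Fin (d + 1) := ⟨min d (N + 1 - k), by omega⟩
    refine span_eq_top_of_specialization hc (Pi.single c₀ 1) w (top_unique ?_)
    rw [← (Pi.basisFun K (Fin (N + 1))).span_eq, Submodule.span_le]
    rintro _ ⟨y, rfl⟩
    apply Submodule.subset_span
    have hy := y.2
    by_cases h1 : q ≤ (y : ℕ)
    · refine ⟨.inl y, ?_⟩
      funext x
      by_cases hx : x = y <;> simp [w, h1, hx]
    by_cases h2 : k + (y : ℕ) ≤ N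
    · refine ⟨.inr (.inl y), ?_⟩
      funext x
      by_cases hx : x = y <;> simp [w, h2, hx]
    · refine ⟨.inr (.inr ⟨y - min d (N + 1 - k), by omega⟩), ?_⟩
      funext x
      have hx2 := x.2
      simp only [w, Pi.basisFun_apply]
      by_cases hx : x = y
      · subst hx
        rw [dif_pos (by omega)]
        have : (⟨(x : ℕ) - (x - min d (N + 1 - k)), by omega⟩ : Fin (d + 1)) = c₀ := by
          ext; simp only [c₀]; omega
        simp only [aeval_X, this, Pi.single_eq_same]
      · have hxn : (x : ℕ) ≠ y := fun h => hx (Fin.ext h)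
        rw [Pi.single_eq_of_ne hx]
        split_ifs with h
        · rw [aeval_X, Pi.single_eq_of_ne]
          intro he
          have := congrArg Fin.val he
          simp only [c₀] at this
          omega
        · simp
  let L : (Fin (N + 1) → K) →ₗ[K] R :=
    Fintype.linearCombination K fun x : Fin (N + 1) => ℓ ^ (x : ℕ) * z ^ (N - x)
  have hL : ∀ v, L v = ∑ x, v x • (ℓ ^ (x : ℕ) * z ^ (N - x)) := fun v =>
    Fintype.linearCombination_apply K _ v
  have hsub : Submodule.map L ⊤ ≤ binarySpan K ℓ z g q d k N := by
    rw [← htop, Submodule.map_span, Submodule.span_le]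
    rintro _ ⟨_, ⟨s, rfl⟩, rfl⟩
    rcases s with y | y | u
    · by_cases h : q ≤ (y : ℕ)
      · refine Submodule.subset_span ⟨y - q, N - y, .inl ⟨by omega, ?_⟩⟩
        rw [hL, Finset.sum_eq_single y]
        · simp only [w, h, and_self, if_true, map_one, one_smul]
          rw [← mul_assoc, ← pow_add, Nat.add_sub_cancel' h]
        · intro x _ hx
          simp [w, hx]
        · simp
      · have : L (fun x => aeval c (w (.inl y) x)) = 0 := by simp [hL, w, h]
        simp only [this]
        exact zero_mem _
    · by_cases h : k + (y : ℕ) ≤ N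
      · refine Submodule.subset_span ⟨y, N - k - y, .inr (.inr ⟨by omega, ?_⟩)⟩
        rw [hL, Finset.sum_eq_single y]
        · simp only [w, h, and_self, if_true, map_one, one_smul]
          rw [mul_left_comm, ← pow_add]
          congr 2; omega
        · intro x _ hx
          simp [w, hx]
        · simp
      · have : L (fun x => aeval c (w (.inr (.inl y)) x)) = 0 := by simp [hL, w, h]
        simp only [this]
        exact zero_mem _
    · by_cases h : (u : ℕ) + d ≤ N
      · refine Submodule.subset_span ⟨u, N - d - u, .inr (.inl ⟨by omega, ?_⟩)⟩
        rw [hL, hg, Finset.sum_mul]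
        symm
        refine Finset.sum_of_injOn (fun j : Fin (d + 1) => ⟨u + j, by omega⟩) ?_ (by simp) ?_ ?_
        · intro i _ j _ hij
          have := congrArg Fin.val hij
          dsimp only at this
          exact Fin.ext (by omega)
        · intro x _ hx
          have : ¬ ((u : ℕ) ≤ x ∧ (x : ℕ) < u + d + 1) := by
            rintro ⟨h1, h2⟩
            exact hx ⟨⟨x - u, by omega⟩, by simp, Fin.ext (by dsimp only; omega)⟩
          have hw : w (.inr (.inr u)) x = 0 := dif_neg fun hx' => this hx'.2
          simp [hw]
        · intro j _
          have hj := j.2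
          simp only [w]
          rw [dif_pos (by omega), aeval_X]
          have : (⟨(u : ℕ) + j - u, by omega⟩ : Fin (d + 1)) = j := Fin.ext (by simp)
          rw [this, smul_mul_assoc, mul_mul_mul_comm, ← pow_add, ← pow_add]
          congr 3 <;> omega
      · have : L (fun x => aeval c (w (.inr (.inr u)) x)) = 0 := by simp [hL, w, h]
        simp only [this]
        exact zero_mem _
  refine hsub ⟨Pi.single ⟨a, by omega⟩ 1, trivial, ?_⟩
  rw [hL, Finset.sum_eq_single ⟨a, by omega⟩]
  · simp only [Pi.single_eq_same, one_smul]
    congr 2; omega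
  · intro x _ hx
    simp [hx]
  · simp

section Strings

variable {K R : Type*} [Field K] [CommRing R] [Algebra K R]

/-- The elements that modulo `I` are combinations of members `ℓ^a e` of degree `t` of Lefschetz
strings: `e` lies in `W i`, and `ℓ^q e` vanishes modulo `I` for `q = δ + 1 - 2i`. -/
def stringSpan (W : ℕ → Submodule K R) (I : Ideal R) (ℓ : R) (δ t : ℕ) : Submodule K R :=
  I.restrictScalars K ⊔ Submodule.span K {x | ∃ (a i q : ℕ) (e : R), e ∈ W i ∧ a + i = t ∧
    q + 2 * i = δ + 1 ∧ ℓ ^ q * e ∈ I ∧ x = ℓ ^ a * e}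

/-- The sum of `I` and the multiples of `z^k` by elements of degree `t - k`. -/
def lefschetzSpan (W : ℕ → Submodule K R) (I : Ideal R) (z : R) (k t : ℕ) : Submodule K R :=
  I.restrictScalars K ⊔ Submodule.span K {x | ∃ (s : ℕ) (w : R), w ∈ W s ∧ k + s = t ∧
    x = z ^ k * w}

theorem mem_lefschetzSpan {W : ℕ → Submodule K R} {I : Ideal R} {z x : R} {k t : ℕ}
    (hx : x ∈ lefschetzSpan W I z k t) :
    x ∈ I ∨ ∃ (s : ℕ) (w : R), w ∈ W s ∧ k + s = t ∧ x - z ^ k * w ∈ I := by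
  obtain ⟨y, hy, u, hu, rfl⟩ := Submodule.mem_sup.1 hx
  by_cases hkt : k ≤ t
  · right
    refine ⟨t - k, ?_⟩
    have hle : Submodule.span K {x | ∃ (s : ℕ) (w : R), w ∈ W s ∧ k + s = t ∧ x = z ^ k * w} ≤
        (W (t - k)).map (LinearMap.mulLeft K (z ^ k)) := by
      rw [Submodule.span_le]
      rintro _ ⟨s, w, hw, rfl, rfl⟩
      exact ⟨w, by simpa using hw, rfl⟩
    obtain ⟨w, hw, rfl⟩ := hle hu
    exact ⟨w, hw, by omega, by simpa using hy⟩
  · left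
    have : {x | ∃ (s : ℕ) (w : R), w ∈ W s ∧ k + s = t ∧ x = z ^ k * w} = ∅ := by
      ext x
      simp only [Set.mem_ofPred_eq, Set.mem_empty_iff_false, iff_false]
      rintro ⟨s, w, -, h, -⟩
      omega
    rw [this, Submodule.span_empty, Submodule.mem_bot] at hu
    rw [hu, add_zero]
    exact hy

/-- If `R/I` is spanned by Lefschetz strings for `ℓ`, then adjoining a variable `z` and a form
`g` of degree `d` in `ℓ, z` that is in general position gives a quotient on which multiplication
by the appropriate powers of `z` is surjective. -/
theorem le_lefschetzSpan_of_le_stringSpan {W W' : ℕ → Submodule K R} {I I' : Ideal R}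
    {ℓ z g : R} {d δ δ' : ℕ} (hδ' : δ' + 1 = δ + d)
    (hbin : ∀ q k N a b : ℕ, q + d + k = 2 * N + 2 → a + b = N →
      ℓ ^ a * z ^ b ∈ binarySpan K ℓ z g q d k N)
    (hI : I ≤ I') (hg : g ∈ I') (hW : ∀ i, W i ≤ W' i)
    (hW' : ∀ t, W' t ≤ Submodule.span K {x | ∃ (b i : ℕ) (w : R), w ∈ W i ∧ b + i = t ∧
      x = z ^ b * w})
    (hℓ : ∀ i, ∀ w ∈ W' i, ℓ * w ∈ W' (i + 1)) (hz : ∀ i, ∀ w ∈ W' i, z * w ∈ W' (i + 1))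
    (hstr : ∀ t, W t ≤ stringSpan W I ℓ δ t) {k t : ℕ} (hkt : k + δ' = 2 * t) :
    W' t ≤ lefschetzSpan W' I' z k t := by
  have hpow : ∀ y : R, (∀ i, ∀ w ∈ W' i, y * w ∈ W' (i + 1)) →
      ∀ u i, ∀ w ∈ W' i, y ^ u * w ∈ W' (i + u) := by
    intro y hy u
    induction u with
    | zero => simp
    | succ u ih =>
      intro i w hw
      rw [pow_succ', mul_assoc, ← add_assoc]
      exact hy _ _ (ih i w hw)
  have hI' : ∀ y ∈ I', y ∈ lefschetzSpan W' I' z k t := fun y hy =>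
    Submodule.mem_sup_left hy
  refine (hW' t).trans (Submodule.span_le.2 ?_)
  rintro _ ⟨b, j, w, hw, hbj, rfl⟩
  have hle : stringSpan W I ℓ δ j ≤
      (lefschetzSpan W' I' z k t).comap (LinearMap.mulLeft K (z ^ b)) := by
    refine sup_le (fun y hy => hI' _ (I'.mul_mem_left _ (hI hy))) (Submodule.span_le.2 ?_)
    rintro _ ⟨a, i, q, e, he, hai, hq, hqe, rfl⟩
    have hbs := hbin q k (a + b) a b (by omega) rfl
    have hle' : binarySpan K ℓ z g q d k (a + b) ≤
        (lefschetzSpan W' I' z k t).comap (LinearMap.mulRight K e) := by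
      refine Submodule.span_le.2 ?_
      rintro _ ⟨u, v, ⟨-, rfl⟩ | ⟨-, rfl⟩ | ⟨h, rfl⟩⟩
      · refine hI' _ ?_
        rw [LinearMap.mulRight_apply, mul_right_comm]
        exact I'.mul_mem_right _ (hI hqe)
      · refine hI' _ ?_
        rw [LinearMap.mulRight_apply, mul_assoc]
        exact I'.mul_mem_right _ hg
      · refine Submodule.mem_sup_right (Submodule.subset_span
          ⟨i + v + u, ℓ ^ u * (z ^ v * e), ?_, by omega, ?_⟩)
        · exact hpow ℓ hℓ _ _ _ (hpow z hz _ _ _ (hW i he))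
        · rw [LinearMap.mulRight_apply]; ring
    have := hle' hbs
    rw [Submodule.mem_comap, LinearMap.mulRight_apply] at this
    have hring : z ^ b * (ℓ ^ a * e) = ℓ ^ a * z ^ b * e := by ring
    rwa [← hring] at this
  exact hle (hstr j hw)

/-- Surjectivity of multiplication by powers of `z` implies spanning by Lefschetz strings. -/
theorem le_stringSpan_of_le_lefschetzSpan {W : ℕ → Submodule K R} {I : Ideal R} {z : R} {δ : ℕ}
    (hz : ∀ i, ∀ w ∈ W i, z * w ∈ W (i + 1))
    (hsurj : ∀ k t, k + δ = 2 * t → W t ≤ lefschetzSpan W I z k t) (t : ℕ) :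
    W t ≤ stringSpan W I z δ t := by
  have hpow : ∀ u i, ∀ w ∈ W i, z ^ u * w ∈ W (i + u) := by
    intro u
    induction u with
    | zero => simp
    | succ u ih =>
      intro i w hw
      rw [pow_succ', mul_assoc, ← add_assoc]
      exact hz _ _ (ih i w hw)
  have hmul : ∀ k s, ∀ x ∈ stringSpan W I z δ s, z ^ k * x ∈ stringSpan W I z δ (k + s) := by
    intro k s
    have : stringSpan W I z δ s ≤
        (stringSpan W I z δ (k + s)).comap (LinearMap.mulLeft K (z ^ k)) := by
      refine sup_le (fun y hy => Submodule.mem_sup_left (I.mul_mem_left _ hy))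
        (Submodule.span_le.2 ?_)
      rintro _ ⟨a, i, q, e, he, hai, hq, hqe, rfl⟩
      refine Submodule.mem_sup_right (Submodule.subset_span
        ⟨k + a, i, q, e, he, by omega, hq, hqe, ?_⟩)
      rw [LinearMap.mulLeft_apply, pow_add, mul_assoc]
    exact fun x hx => this hx
  have hI : ∀ s, ∀ y ∈ I, y ∈ stringSpan W I z δ s := fun s y hy => Submodule.mem_sup_left hy
  induction t using Nat.strong_induction_on with
  | _ t ih =>
    intro w hw
    rcases le_or_gt (2 * t) (δ + 1) with h | h
    · obtain ⟨q, hq⟩ := Nat.exists_eq_add_of_le h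
      have hmem : ∀ e ∈ W t, z ^ q * e ∈ I → e ∈ stringSpan W I z δ t := fun e he hqe =>
        Submodule.mem_sup_right (Submodule.subset_span
          ⟨0, t, q, e, he, by omega, by omega, hqe, by simp⟩)
      rcases mem_lefschetzSpan (hsurj (q + 1) (t + q) (by omega) (hpow q t w hw)) with h0 | h0
      · exact hmem w hw h0
      · obtain ⟨s, b, hb, hs, hdiff⟩ := h0
        obtain rfl : t = s + 1 := by omega
        have he : w - z * b ∈ stringSpan W I z δ (s + 1) := by
          refine hmem _ (sub_mem hw (hz _ _ hb)) ?_
          convert hdiff using 1; ring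
        have hb' := hmul 1 s b (ih s (by omega) hb)
        rw [pow_one, add_comm 1 s] at hb'
        simpa using add_mem he hb'
    · obtain ⟨k, hk⟩ := Nat.exists_eq_add_of_le (show δ ≤ 2 * t by omega)
      rcases mem_lefschetzSpan (hsurj k t (by omega) hw) with h0 | h0
      · exact hI _ _ h0
      · obtain ⟨s, b, hb, hs, hdiff⟩ := h0
        have hb' := hmul k s b (ih s (by omega) hb)
        rw [hs] at hb'
        simpa using add_mem (hI t _ hdiff) hb'

end Strings

theorem expDeg_eq_degree {n : ℕ} (μ : Fin n →₀ ℕ) : expDeg μ = μ.degree := rfl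

theorem expDeg_add {n : ℕ} (μ ν : Fin n →₀ ℕ) : expDeg (μ + ν) = expDeg μ + expDeg ν := by
  simp [expDeg_eq_degree]

theorem expDeg_single {n : ℕ} (i : Fin n) (e : ℕ) : expDeg (Finsupp.single i e) = e := by
  simp [expDeg_eq_degree]

theorem finite_expDeg_eq (n t : ℕ) : {μ : Fin n →₀ ℕ | expDeg μ = t}.Finite :=
  Finsupp.finite_of_degree_eq t

theorem expDeg_sub {n : ℕ} {α μ : Fin n →₀ ℕ} (h : α ≤ μ) :
    expDeg (μ - α) + expDeg α = expDeg μ := by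
  rw [← expDeg_add, tsub_add_cancel_of_le h]

theorem finrank_map_of_injective {K V V' : Type*} [Field K] [AddCommGroup V] [Module K V]
    [AddCommGroup V'] [Module K V'] (L : V →ₗ[K] V') (hL : Function.Injective L)
    (U : Submodule K V) : Module.finrank K (U.map L) = Module.finrank K U :=
  (Submodule.equivMapOfInjective L hL U).finrank_eq.symm

section FormSpan

variable {K : Type*} [Field K] {n : ℕ}

/-- The span of the products `x^α f_j`, `(j, α) ∈ s`, and of the monomials `x^β`, `β ∈ b`. -/
noncomputable def formSpan (f : Fin n → MvPolynomial (Fin n) K) (s : Set (Fin n × (Fin n →₀ ℕ)))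
    (b : Set (Fin n →₀ ℕ)) : Submodule K (MvPolynomial (Fin n) K) :=
  Submodule.span K ((fun p : Fin n × (Fin n →₀ ℕ) => monomial p.2 (1 : K) * f p.1) '' s ∪
    (fun β => monomial β (1 : K)) '' b)

/-- The dimension of `formSpan` is largest for a generic sequence of forms. -/
theorem finrank_formSpan_le {F : Type*} [Field F] [Algebra F K] {d : Fin n → ℕ}
    {f f₀ : Fin n → MvPolynomial (Fin n) K} (hf : IsGenericSeq F d f)
    (hf₀ : ∀ j, (f₀ j).IsHomogeneous (d j)) {s : Set (Fin n × (Fin n →₀ ℕ))}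
    {b : Set (Fin n →₀ ℕ)} (hs : s.Finite) (hb : b.Finite) :
    Module.finrank K (formSpan f₀ s b) ≤ Module.finrank K (formSpan f s b) := by
  classical
  have := hs.to_subtype
  have := hb.to_subtype
  let Φ : MvPolynomial (Fin n) K →ₗ[K] ((Fin n →₀ ℕ) → K) :=
    LinearMap.pi fun μ => lcoeff K μ
  have hΦ : Function.Injective Φ := fun p q h => MvPolynomial.ext _ _ fun μ => congrFun h μ
  let ι := Σ i : Fin n, { μ : Fin n →₀ ℕ // expDeg μ = d i }
  let w : s ⊕ b → (Fin n →₀ ℕ) → MvPolynomial ι F := fun x μ => match x with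
    | .inl p => if h : p.1.2 ≤ μ ∧ expDeg (μ - p.1.2) = d p.1.1 then
        X ⟨p.1.1, μ - p.1.2, h.2⟩ else 0
    | .inr β => if β.1 = μ then 1 else 0
  have key : ∀ h : Fin n → MvPolynomial (Fin n) K, (∀ j, (h j).IsHomogeneous (d j)) →
      Module.finrank K (formSpan h s b) = Module.finrank K (Submodule.span K
        (Set.range fun x μ => aeval (fun p : ι => (h p.1).coeff p.2.1) (w x μ))) := by
    intro h hh
    have hl : ∀ p : s, Φ (monomial p.1.2 (1 : K) * h p.1.1) =
        fun μ => aeval (fun p : ι => (h p.1).coeff p.2.1) (w (.inl p) μ) := by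
      intro p
      funext μ
      simp only [Φ, LinearMap.pi_apply, lcoeff_apply, coeff_monomial_mul', one_mul, w]
      by_cases h1 : p.1.2 ≤ μ
      · by_cases h2 : expDeg (μ - p.1.2) = d p.1.1
        · rw [if_pos h1, dif_pos ⟨h1, h2⟩, aeval_X]
        · rw [if_pos h1, dif_neg fun h' => h2 h'.2, map_zero]
          exact (hh _).coeff_eq_zero h2
      · rw [if_neg h1, dif_neg fun h' => h1 h'.1, map_zero]
    have hr : ∀ β : b, Φ (monomial β.1 (1 : K)) =
        fun μ => aeval (fun p : ι => (h p.1).coeff p.2.1) (w (.inr β) μ) := by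
      intro β
      funext μ
      simp only [Φ, LinearMap.pi_apply, lcoeff_apply, coeff_monomial, w]
      split_ifs <;> simp
    rw [← finrank_map_of_injective Φ hΦ, formSpan, Submodule.map_span, Set.image_union,
      Set.image_image, Set.image_image, Set.image_eq_range, Set.image_eq_range, Sum.range_eq]
    rw [funext hl, funext hr]
    rfl
  rw [key f hf.1, key f₀ hf₀]
  exact finrank_span_le_of_specialization hf.2 _ w

theorem finrank_span_monomial {b : Set (Fin n →₀ ℕ)} (hb : b.Finite) :
    Module.finrank K (Submodule.span K ((fun β => monomial β (1 : K)) '' b)) = b.ncard := by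
  have := hb.fintype
  have hli : LinearIndependent K fun β : b => monomial β.1 (1 : K) := by
    have := (basisMonomials (Fin n) K).linearIndependent
    rw [coe_basisMonomials] at this
    exact this.comp _ Subtype.val_injective
  rw [Set.image_eq_range, finrank_span_eq_card hli, ← Nat.card_coe_set_eq, Nat.card_eq_fintype_card]

theorem homogeneousSubmodule_eq_span (t : ℕ) :
    homogeneousSubmodule (Fin n) K t =
      Submodule.span K ((fun β => monomial β (1 : K)) '' {μ | expDeg μ = t}) := by
  apply le_antisymm
  · intro p hp
    rw [p.as_sum]
    refine Submodule.sum_mem _ fun μ hμ => ?_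
    rw [← mul_one (coeff μ p), ← smul_eq_mul, ← smul_monomial]
    refine Submodule.smul_mem _ _ (Submodule.subset_span ⟨μ, ?_, rfl⟩)
    by_contra hne
    exact (mem_support_iff.1 hμ) (IsHomogeneous.coeff_eq_zero hp hne)
  · rw [Submodule.span_le]
    rintro _ ⟨μ, hμ, rfl⟩
    exact isHomogeneous_monomial _ hμ

theorem finrank_homogeneousSubmodule (t : ℕ) :
    Module.finrank K (homogeneousSubmodule (Fin n) K t) =
      {μ : Fin n →₀ ℕ | expDeg μ = t}.ncard := by
  rw [homogeneousSubmodule_eq_span, finrank_span_monomial (finite_expDeg_eq n t)]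

instance finiteDimensional_homogeneousSubmodule (t : ℕ) :
    FiniteDimensional K (homogeneousSubmodule (Fin n) K t) := by
  rw [homogeneousSubmodule_eq_span]
  exact FiniteDimensional.span_of_finite K ((finite_expDeg_eq n t).image _)

end FormSpan

section SupMap

variable {K V : Type*} [Field K] [AddCommGroup V] [Module K V] {P Q U : Submodule K V}
  [FiniteDimensional K P] [FiniteDimensional K U] {L : V →ₗ[K] V}

theorem finrank_sup_map_add_le (hL : Function.Injective L) (hQU : Q ≤ U) (hQP : Q.map L ≤ P) :
    Module.finrank K ↥(P ⊔ U.map L) + Module.finrank K Q ≤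
      Module.finrank K P + Module.finrank K U := by
  rw [← finrank_map_of_injective L hL U, ← finrank_map_of_injective L hL Q,
    ← Submodule.finrank_sup_add_finrank_inf_eq P (U.map L)]
  gcongr
  exact Submodule.finrank_mono (le_inf hQP (Submodule.map_mono hQU))

theorem mem_of_map_mem_of_finrank_le (hL : Function.Injective L) (hQU : Q ≤ U)
    (hQP : Q.map L ≤ P)
    (hle : Module.finrank K P + Module.finrank K U ≤
      Module.finrank K ↥(P ⊔ U.map L) + Module.finrank K Q) {u : V} (hu : u ∈ U) (hLu : L u ∈ P) :
    u ∈ Q := by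
  rw [← finrank_map_of_injective L hL U, ← finrank_map_of_injective L hL Q,
    ← Submodule.finrank_sup_add_finrank_inf_eq P (U.map L)] at hle
  have heq := Submodule.eq_of_le_of_finrank_le (le_inf hQP (Submodule.map_mono hQU))
    (Nat.le_of_add_le_add_left hle)
  obtain ⟨q, hq, hqu⟩ : L u ∈ Q.map L := heq ▸ Submodule.mem_inf.2 ⟨hLu, u, hu, rfl⟩
  exact hL hqu ▸ hq

end SupMap

section HilbertFunction

variable {K : Type*} [Field K] {n : ℕ}

/-- The degree `t` part of the ideal generated by the forms `f j`, `j < r`, of degrees `d j`. -/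
noncomputable def degPart (f : Fin n → MvPolynomial (Fin n) K) (d : Fin n → ℕ) (r t : ℕ) :
    Submodule K (MvPolynomial (Fin n) K) :=
  formSpan f {p | (p.1 : ℕ) < r ∧ expDeg p.2 + d p.1 = t} ∅

theorem monomial_mul_mem_degPart (f : Fin n → MvPolynomial (Fin n) K) {d : Fin n → ℕ} {r t : ℕ}
    {j : Fin n} {α : Fin n →₀ ℕ} (hj : (j : ℕ) < r) (ht : expDeg α + d j = t) :
    monomial α (1 : K) * f j ∈ degPart f d r t :=
  Submodule.subset_span (.inl ⟨(j, α), ⟨hj, ht⟩, rfl⟩)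

theorem degPart_le_iff {f : Fin n → MvPolynomial (Fin n) K} {d : Fin n → ℕ} {r t : ℕ}
    {S : Submodule K (MvPolynomial (Fin n) K)} :
    degPart f d r t ≤ S ↔ ∀ (j : Fin n) (α : Fin n →₀ ℕ), (j : ℕ) < r → expDeg α + d j = t →
      monomial α (1 : K) * f j ∈ S := by
  rw [degPart, formSpan, Submodule.span_le, Set.image_empty, Set.union_empty, Set.image_subset_iff]
  exact ⟨fun h j α hj ht => @h (j, α) ⟨hj, ht⟩, fun h p hp => h _ _ hp.1 hp.2⟩

theorem degPart_le_homogeneousSubmodule {f : Fin n → MvPolynomial (Fin n) K} {d : Fin n → ℕ}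
    (hf : ∀ j, (f j).IsHomogeneous (d j)) (r t : ℕ) :
    degPart f d r t ≤ homogeneousSubmodule (Fin n) K t :=
  degPart_le_iff.2 fun j _ _ ht => ht ▸ (isHomogeneous_monomial _ rfl).mul (hf j)

theorem finite_degPart_index (d : Fin n → ℕ) (r t : ℕ) :
    {p : Fin n × (Fin n →₀ ℕ) | (p.1 : ℕ) < r ∧ expDeg p.2 + d p.1 = t}.Finite :=
  (Set.finite_univ.prod (Finsupp.finite_of_degree_le t)).subset fun p hp =>
    ⟨trivial, by have := hp.2; rw [expDeg_eq_degree] at this; exact this ▸ Nat.le_add_right _ _⟩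

instance finiteDimensional_degPart (f : Fin n → MvPolynomial (Fin n) K) (d : Fin n → ℕ)
    (r t : ℕ) : FiniteDimensional K (degPart f d r t) := by
  refine FiniteDimensional.span_of_finite K (((finite_degPart_index d r t).image _).union ?_)
  rw [Set.image_empty]
  exact Set.finite_empty

theorem monomial_mul_degPart_le (f : Fin n → MvPolynomial (Fin n) K) (d : Fin n → ℕ) (r t : ℕ)
    (α : Fin n →₀ ℕ) {p : MvPolynomial (Fin n) K} (hp : p ∈ degPart f d r t) :
    monomial α (1 : K) * p ∈ degPart f d r (expDeg α + t) := by
  have : degPart f d r t ≤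
      (degPart f d r (expDeg α + t)).comap (LinearMap.mulLeft K (monomial α 1)) :=
    degPart_le_iff.2 fun j β hj ht => by
      rw [Submodule.mem_comap, LinearMap.mulLeft_apply, ← mul_assoc, monomial_mul, one_mul]
      exact monomial_mul_mem_degPart f hj (by rw [expDeg_add]; omega)
  exact this hp

theorem mul_mem_degPart {f : Fin n → MvPolynomial (Fin n) K} {d : Fin n → ℕ} {r t e : ℕ}
    {p q : MvPolynomial (Fin n) K} (hq : q.IsHomogeneous e) (hp : p ∈ degPart f d r t) :
    q * p ∈ degPart f d r (e + t) := by
  have : homogeneousSubmodule (Fin n) K e ≤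
      (degPart f d r (e + t)).comap (LinearMap.mulRight K p) := by
    rw [homogeneousSubmodule_eq_span, Submodule.span_le]
    rintro _ ⟨α, rfl, rfl⟩
    exact monomial_mul_degPart_le f d r t α hp
  exact this hq

/-- The monomials of degree `t` divisible by some `x_j^{d_j}` with `j < r`. -/
def powerMultiples (d : Fin n → ℕ) (r t : ℕ) : Set (Fin n →₀ ℕ) :=
  {μ | expDeg μ = t ∧ ∃ j : Fin n, (j : ℕ) < r ∧ d j ≤ μ j}

/-- The monomials of degree `t` not divisible by any `x_j^{d_j}` with `j < r`. -/
def boxMonomials (d : Fin n → ℕ) (r t : ℕ) : Set (Fin n →₀ ℕ) :=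
  {μ | expDeg μ = t ∧ ∀ j : Fin n, (j : ℕ) < r → μ j < d j}

theorem finite_powerMultiples (d : Fin n → ℕ) (r t : ℕ) : (powerMultiples d r t).Finite :=
  (finite_expDeg_eq n t).subset fun _ h => h.1

theorem finite_boxMonomials (d : Fin n → ℕ) (r t : ℕ) : (boxMonomials d r t).Finite :=
  (finite_expDeg_eq n t).subset fun _ h => h.1

theorem ncard_powerMultiples_add (d : Fin n → ℕ) (r t : ℕ) :
    (powerMultiples d r t).ncard + (boxMonomials d r t).ncard =
      {μ : Fin n →₀ ℕ | expDeg μ = t}.ncard := by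
  rw [← Set.ncard_union_eq _ (finite_powerMultiples d r t) (finite_boxMonomials d r t)]
  · congr 1
    ext μ
    constructor
    · rintro (h | h) <;> exact h.1
    · intro h
      by_cases h' : ∃ j : Fin n, (j : ℕ) < r ∧ d j ≤ μ j
      · exact .inl ⟨h, h'⟩
      · push Not at h'
        exact .inr ⟨h, h'⟩
  · rw [Set.disjoint_left]
    rintro μ ⟨-, j, hj, hle⟩ ⟨-, h⟩
    exact (h j hj).not_ge hle

theorem ncard_powerMultiples_succ_ge (d : Fin n → ℕ) (r : Fin n) (t : ℕ) :
    (powerMultiples d r (t + d r)).ncard + (boxMonomials d r t).ncard ≤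
      (powerMultiples d (r + 1) (t + d r)).ncard := by
  have hinj : Function.Injective fun μ : Fin n →₀ ℕ => μ + Finsupp.single r (d r) :=
    add_left_injective _
  rw [← Set.ncard_image_of_injective (boxMonomials d r t) hinj,
    ← Set.ncard_union_eq _ (finite_powerMultiples d r _) ((finite_boxMonomials d r t).image _)]
  · refine Set.ncard_le_ncard ?_ (finite_powerMultiples d _ _)
    rintro _ (⟨h, j, hj, hle⟩ | ⟨μ, ⟨rfl, -⟩, rfl⟩)
    · exact ⟨h, j, by omega, hle⟩
    · exact ⟨by rw [expDeg_add, expDeg_single], r, by omega, by simp⟩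
  · rw [Set.disjoint_left]
    rintro _ ⟨-, j, hj, hle⟩ ⟨μ, ⟨-, h⟩, rfl⟩
    have hne : r ≠ j := fun h => by subst h; omega
    have := h j hj
    simp [hne] at hle
    omega

/-- The Hilbert function of `n` forms whose exponents bound a box is symmetric. -/
theorem ncard_boxMonomials_le {d : Fin n → ℕ} {i j : ℕ} (hij : i + j + n = ∑ k, d k) :
    (boxMonomials d n i).ncard ≤ (boxMonomials d n j).ncard := by
  let φ : (Fin n →₀ ℕ) → (Fin n →₀ ℕ) := fun μ => Finsupp.equivFunOnFinite.symm
    fun k => d k - 1 - μ k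
  refine Set.ncard_le_ncard_of_injOn φ ?_ ?_ (finite_boxMonomials d n j)
  · rintro μ ⟨hμ, hlt⟩
    have hlt' : ∀ k, μ k < d k := fun k => hlt k k.2
    refine ⟨?_, fun k _ => ?_⟩
    · rw [expDeg_eq_degree, Finsupp.degree_eq_sum] at hμ ⊢
      have h1 : ∑ k, (φ μ k + μ k + 1) = ∑ k, d k := Finset.sum_congr rfl fun k _ => by
        have := hlt' k
        simp only [φ, Finsupp.equivFunOnFinite_symm_apply_apply]
        omega
      simp only [Finset.sum_add_distrib, Finset.sum_const, Finset.card_univ, Fintype.card_fin,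
        smul_eq_mul, mul_one] at h1
      omega
    · have := hlt' k
      simp only [φ, Finsupp.equivFunOnFinite_symm_apply_apply]
      omega
  · intro μ hμ ν hν h
    ext k
    have h1 := hμ.2 k k.2
    have h2 := hν.2 k k.2
    have h3 := DFunLike.congr_fun h k
    simp only [φ, Finsupp.equivFunOnFinite_symm_apply_apply] at h3
    omega

variable {F : Type*} [Field F] [Algebra F K] {d : Fin n → ℕ} {f : Fin n → MvPolynomial (Fin n) K}

theorem IsGenericSeq.ne_zero (hf : IsGenericSeq F d f) (j : Fin n) : f j ≠ 0 := by
  intro h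
  exact hf.2.ne_zero ⟨j, Finsupp.single j (d j), expDeg_single _ _⟩ (by simp [h])

theorem ncard_powerMultiples_le_finrank_degPart (hf : IsGenericSeq F d f) (r t : ℕ) :
    (powerMultiples d r t).ncard ≤ Module.finrank K (degPart f d r t) := by
  refine le_trans ?_ (finrank_formSpan_le (f₀ := fun j => monomial (Finsupp.single j (d j)) 1) hf
    (fun j => isHomogeneous_monomial _ (expDeg_single _ _)) (finite_degPart_index d r t)
    Set.finite_empty)
  rw [← finrank_span_monomial (K := K) (finite_powerMultiples d r t)]
  have := finiteDimensional_degPart (fun j => monomial (Finsupp.single j (d j)) (1 : K)) d r t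
  refine Submodule.finrank_mono (t := degPart _ d r t) (Submodule.span_le.2 ?_)
  rintro _ ⟨μ, ⟨ht, j, hj, hle⟩, rfl⟩
  have hle' : Finsupp.single j (d j) ≤ μ := by simpa using hle
  have hsub := expDeg_sub hle'
  rw [expDeg_single, ht] at hsub
  have := monomial_mul_mem_degPart (fun j => monomial (Finsupp.single j (d j)) (1 : K)) hj hsub
  rwa [monomial_mul, one_mul, tsub_add_cancel_of_le hle'] at this

theorem finrank_degPart_le_ncard_powerMultiples (hf : IsGenericSeq F d f) {r : ℕ} (hr : r ≤ n) :
    ∀ t, Module.finrank K (degPart f d r t) ≤ (powerMultiples d r t).ncard := by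
  induction r with
  | zero =>
    intro t
    have : degPart f d 0 t = ⊥ := le_bot_iff.1 (degPart_le_iff.2 fun j α hj => absurd hj (by omega))
    rw [this, finrank_bot]
    exact Nat.zero_le _
  | succ r ih =>
    intro t
    let j : Fin n := ⟨r, hr⟩
    have ih := ih (Nat.le_of_succ_le hr)
    rcases lt_or_ge t (d j) with ht | ht
    · have hle : degPart f d (r + 1) t ≤ degPart f d r t := degPart_le_iff.2 fun k α hk hkt => by
        rcases Nat.lt_succ_iff_lt_or_eq.1 hk with h | h
        · exact monomial_mul_mem_degPart f h hkt
        · obtain rfl : k = j := Fin.ext h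
          omega
      refine (Submodule.finrank_mono hle).trans ((ih t).trans
        (Set.ncard_le_ncard ?_ (finite_powerMultiples d _ _)))
      rintro μ ⟨h, k, hk, hle⟩
      exact ⟨h, k, by omega, hle⟩
    · obtain ⟨u, rfl⟩ := Nat.exists_eq_add_of_le' ht
      let L := LinearMap.mulLeft K (f j)
      have hL : Function.Injective L := mul_right_injective₀ (hf.ne_zero j)
      have hle : degPart f d (r + 1) (u + d j) ≤
          degPart f d r (u + d j) ⊔ (homogeneousSubmodule (Fin n) K u).map L :=
        degPart_le_iff.2 fun k α hk hkt => by
          rcases Nat.lt_succ_iff_lt_or_eq.1 hk with h | h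
          · exact Submodule.mem_sup_left (monomial_mul_mem_degPart f h hkt)
          · obtain rfl : k = j := Fin.ext h
            exact Submodule.mem_sup_right ⟨monomial α 1,
              isHomogeneous_monomial _ (Nat.add_right_cancel hkt), mul_comm _ _⟩
      have h1 := Submodule.finrank_mono hle
      have h2 := finrank_sup_map_add_le (P := degPart f d r (u + d j))
        (Q := degPart f d r u) hL (degPart_le_homogeneousSubmodule hf.1 r u) (by
          rintro _ ⟨p, hp, rfl⟩
          rw [add_comm u]
          exact mul_mem_degPart (hf.1 j) hp)
      rw [finrank_homogeneousSubmodule, ← ncard_powerMultiples_add d r u] at h2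
      have h3 := ncard_powerMultiples_le_finrank_degPart hf r u
      have h4 := ncard_powerMultiples_succ_ge d j u
      have h5 := ih (u + d j)
      simp only [j] at *
      omega

theorem finrank_degPart (hf : IsGenericSeq F d f) (t : ℕ) :
    Module.finrank K (degPart f d n t) = (powerMultiples d n t).ncard :=
  le_antisymm (finrank_degPart_le_ncard_powerMultiples hf le_rfl t)
    (ncard_powerMultiples_le_finrank_degPart hf n t)

end HilbertFunction

section Specialization

variable {K : Type*} [Field K] {n : ℕ}

/-- The forms of degree `t` in the first `m` variables. -/
noncomputable def initialForms (K : Type*) [Field K] (n m t : ℕ) :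
    Submodule K (MvPolynomial (Fin n) K) :=
  Submodule.span K ((fun β => monomial β (1 : K)) ''
    {μ : Fin n →₀ ℕ | expDeg μ = t ∧ ∀ j : Fin n, m ≤ (j : ℕ) → μ j = 0})

/-- The last of the first `m` variables, or `0` if there is none. -/
noncomputable def prevVar (K : Type*) [Field K] (n m : ℕ) : MvPolynomial (Fin n) K :=
  if h : 0 < m ∧ m ≤ n then X ⟨m - 1, by omega⟩ else 0

theorem prevVar_zero : prevVar K n 0 = 0 := dif_neg (by omega)

theorem prevVar_succ (j : Fin n) : prevVar K n (j + 1) = X j :=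
  dif_pos ⟨Nat.succ_pos _, j.2⟩

theorem X_mul_mem_initialForms {m t : ℕ} {j : Fin n} (hj : (j : ℕ) < m)
    {w : MvPolynomial (Fin n) K} (hw : w ∈ initialForms K n m t) :
    X j * w ∈ initialForms K n m (t + 1) := by
  have : initialForms K n m t ≤
      (initialForms K n m (t + 1)).comap (LinearMap.mulLeft K (X j)) := by
    refine Submodule.span_le.2 ?_
    rintro _ ⟨μ, ⟨rfl, hμ⟩, rfl⟩
    refine Submodule.subset_span ⟨Finsupp.single j 1 + μ, ⟨?_, fun k hk => ?_⟩, ?_⟩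
    · rw [expDeg_add, expDeg_single, add_comm]
    · have : j ≠ k := fun h => by subst h; omega
      simp [this, hμ k hk]
    · rw [LinearMap.mulLeft_apply, X, monomial_mul, one_mul]
  exact this hw

theorem initialForms_mono {m m' : ℕ} (h : m ≤ m') (t : ℕ) :
    initialForms K n m t ≤ initialForms K n m' t :=
  Submodule.span_mono (Set.image_mono fun _ hμ => ⟨hμ.1, fun j hj => hμ.2 j (h.trans hj)⟩)

theorem initialForms_succ_le (j : Fin n) (t : ℕ) : initialForms K n (j + 1) t ≤
    Submodule.span K {x | ∃ (b i : ℕ) (w : MvPolynomial (Fin n) K), w ∈ initialForms K n j i ∧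
      b + i = t ∧ x = X j ^ b * w} := by
  refine Submodule.span_le.2 ?_
  rintro _ ⟨μ, ⟨rfl, hμ⟩, rfl⟩
  have hle : Finsupp.single j (μ j) ≤ μ := by simp
  refine Submodule.subset_span ⟨μ j, expDeg (μ - Finsupp.single j (μ j)),
    monomial (μ - Finsupp.single j (μ j)) 1, Submodule.subset_span ⟨_, ⟨rfl, fun k hk => ?_⟩, rfl⟩,
    ?_, ?_⟩
  · rcases Nat.eq_or_lt_of_le hk with h | h
    · obtain rfl : j = k := Fin.ext h
      simp
    · simp [hμ k h]
  · have := expDeg_sub hle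
    rw [expDeg_single] at this
    omega
  · rw [X_pow_eq_monomial, monomial_mul, one_mul, add_tsub_cancel_of_le hle]

theorem homogeneousSubmodule_le_initialForms (t : ℕ) :
    homogeneousSubmodule (Fin n) K t ≤ initialForms K n n t := by
  rw [homogeneousSubmodule_eq_span]
  exact Submodule.span_mono (Set.image_mono fun _ hμ => ⟨hμ, fun j hj => absurd j.2 hj.not_gt⟩)

/-- A form in two consecutive variables in general position. -/
theorem exists_binary_form {F : Type*} [Field F] [Algebra F K] {d : Fin n → ℕ}
    {f : Fin n → MvPolynomial (Fin n) K} (hf : IsGenericSeq F d f) (j : Fin n) :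
    ∃ g : MvPolynomial (Fin n) K, g.IsHomogeneous (d j) ∧
      ∀ q k N a b : ℕ, q + d j + k = 2 * N + 2 → a + b = N →
        prevVar K n j ^ a * X j ^ b ∈ binarySpan K (prevVar K n j) (X j) g q (d j) k N := by
  rcases Nat.eq_zero_or_pos (j : ℕ) with hj | hj
  · refine ⟨X j ^ d j, by simpa using (isHomogeneous_X K j).pow (d j), ?_⟩
    rintro q k N a b hN rfl
    rw [hj, prevVar_zero]
    rcases Nat.eq_zero_or_pos a with rfl | ha
    · simp only [zero_add] at hN ⊢
      rcases Nat.eq_zero_or_pos q with rfl | hq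
      · exact Submodule.subset_span ⟨0, b, .inl ⟨by simp, by simp⟩⟩
      rcases le_or_gt (d j) b with hd | hd
      · exact Submodule.subset_span ⟨0, b - d j, .inr (.inl ⟨by omega, by
          rw [pow_zero, one_mul, one_mul, ← pow_add, Nat.add_sub_cancel' hd]⟩)⟩
      · have hk : k ≤ b := by omega
        exact Submodule.subset_span ⟨0, b - k, .inr (.inr ⟨by omega, by
          rw [pow_zero, one_mul, one_mul, ← pow_add, Nat.add_sub_cancel' hk]⟩)⟩
    · rw [zero_pow ha.ne', zero_mul]
      exact zero_mem _
  · let j' : Fin n := ⟨j - 1, by omega⟩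
    have hne : j' ≠ j := fun h => by
      have := congrArg Fin.val h
      simp only [j'] at this
      omega
    have hprev : prevVar K n j = X j' := dif_pos ⟨hj, j.2.le⟩
    let e : Fin (d j + 1) → Σ i : Fin n, { μ : Fin n →₀ ℕ // expDeg μ = d i } := fun c =>
      ⟨j, Finsupp.single j' (c : ℕ) + Finsupp.single j (d j - c), by
        rw [expDeg_add, expDeg_single, expDeg_single]; omega⟩
    have he : Function.Injective e := by
      intro c c' h
      have h1 := congrArg Subtype.val (eq_of_heq (Sigma.mk.inj h).2)
      have h2 := DFunLike.congr_fun h1 j'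
      simp [hne.symm] at h2
      exact Fin.ext h2
    rw [hprev]
    refine ⟨_, ?_, fun q k N a b hN hab =>
      mem_binarySpan_of_generic (hf.2.comp e he) (X j') (X j) hN hab⟩
    refine IsHomogeneous.sum _ _ _ fun c _ => ?_
    rw [smul_eq_C_mul]
    have h1 := (isHomogeneous_C (Fin n) (((fun p : Σ i : Fin n,
      { μ : Fin n →₀ ℕ // expDeg μ = d i } => (f p.1).coeff p.2.1) ∘ e) c)).mul
      (((isHomogeneous_X K j').pow (c : ℕ)).mul ((isHomogeneous_X K j).pow (d j - c)))
    convert h1 using 1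
    omega

/-- The socle degree of a complete intersection of forms of degrees `d j`, `j < m`. -/
def socleDegree (d : Fin n → ℕ) (m : ℕ) : ℕ :=
  ∑ j ∈ Finset.univ.filter (fun j : Fin n => (j : ℕ) < m), (d j - 1)

theorem socleDegree_zero (d : Fin n → ℕ) : socleDegree d 0 = 0 := by simp [socleDegree]

theorem socleDegree_succ {d : Fin n → ℕ} (hd : ∀ i, 1 ≤ d i) (m : Fin n) :
    socleDegree d (m + 1) + 1 = socleDegree d m + d m := by
  have : Finset.univ.filter (fun j : Fin n => (j : ℕ) < m + 1) =
      insert m (Finset.univ.filter (fun j : Fin n => (j : ℕ) < m)) := by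
    ext j
    simp only [Finset.mem_filter_univ, Finset.mem_insert, Fin.ext_iff]
    omega
  rw [socleDegree, this, Finset.sum_insert (by simp), ← socleDegree]
  have := hd m
  omega

theorem socleDegree_self_add {d : Fin n → ℕ} (hd : ∀ i, 1 ≤ d i) :
    socleDegree d n + n = ∑ j, d j := by
  have h : ∑ j, (d j - 1 + 1) = ∑ j, d j :=
    Finset.sum_congr rfl fun j _ => Nat.sub_add_cancel (hd j)
  rw [← h, Finset.sum_add_distrib, socleDegree, Finset.filter_true_of_mem fun j _ => j.2]
  simp

/-- A sequence of forms in consecutive pairs of variables for which multiplication by powers of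
the last variable is surjective in the expected range. -/
theorem initialForms_le_lefschetzSpan {d : Fin n → ℕ} (hd : ∀ i, 1 ≤ d i)
    {g : Fin n → MvPolynomial (Fin n) K}
    (hg : ∀ (j : Fin n) (q k N a b : ℕ), q + d j + k = 2 * N + 2 → a + b = N →
      prevVar K n j ^ a * X j ^ b ∈ binarySpan K (prevVar K n j) (X j) (g j) q (d j) k N)
    (m : Fin n) : ∀ k t : ℕ, k + socleDegree d (m + 1) = 2 * t →
      initialForms K n (m + 1) t ≤ lefschetzSpan (initialForms K n (m + 1))
        (Ideal.span (g '' {j : Fin n | (j : ℕ) < m + 1})) (X m) k t := by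
  obtain ⟨m, hm⟩ := m
  have step : ∀ (m : Fin n), (∀ t, initialForms K n m t ≤ stringSpan (initialForms K n m)
        (Ideal.span (g '' {j : Fin n | (j : ℕ) < m})) (prevVar K n m)
        (socleDegree d m) t) →
      ∀ k t : ℕ, k + socleDegree d (m + 1) = 2 * t →
      initialForms K n (m + 1) t ≤ lefschetzSpan (initialForms K n (m + 1))
        (Ideal.span (g '' {j : Fin n | (j : ℕ) < m + 1})) (X m) k t := by
    intro m hstr k t hkt
    have hI : Ideal.span (g '' {j : Fin n | (j : ℕ) < m}) ≤
        Ideal.span (g '' {j : Fin n | (j : ℕ) < m + 1}) :=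
      Ideal.span_mono (Set.image_mono fun j (hj : (j : ℕ) < m) => Nat.lt_succ_of_lt hj)
    have hgm : g m ∈ Ideal.span (g '' {j : Fin n | (j : ℕ) < m + 1}) :=
      Ideal.subset_span ⟨m, Nat.lt_succ_self (m : ℕ), rfl⟩
    refine le_lefschetzSpan_of_le_stringSpan (socleDegree_succ hd m) (hg m) hI hgm
      (fun i => initialForms_mono (Nat.le_succ m) i) (initialForms_succ_le m)
      (fun i w hw => ?_) (fun i w hw => X_mul_mem_initialForms (Nat.lt_succ_self _) hw) hstr hkt
    unfold prevVar
    split_ifs with h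
    · exact X_mul_mem_initialForms (by dsimp only; omega) hw
    · rw [zero_mul]
      exact zero_mem _
  refine step ⟨m, hm⟩ ?_
  dsimp only
  induction m with
  | zero =>
    intro t
    refine (Submodule.span_le.2 ?_).trans le_sup_right
    rintro _ ⟨μ, ⟨rfl, hμ⟩, rfl⟩
    obtain rfl : μ = 0 := Finsupp.ext fun j => hμ j (Nat.zero_le _)
    refine Submodule.subset_span ⟨0, 0, 1, monomial 0 1, Submodule.subset_span
      ⟨0, ⟨rfl, fun _ _ => rfl⟩, rfl⟩, rfl, by simp [socleDegree_zero], ?_, by simp⟩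
    rw [prevVar_zero, pow_one, zero_mul]
    exact zero_mem _
  | succ m ih =>
    have hm' : m < n := by omega
    have hprev : prevVar K n (m + 1) = X ⟨m, hm'⟩ := prevVar_succ ⟨m, hm'⟩
    have hsurj := step ⟨m, hm'⟩ (ih hm')
    have hz : ∀ i, ∀ w ∈ initialForms K n (m + 1) i,
        X ⟨m, hm'⟩ * w ∈ initialForms K n (m + 1) (i + 1) :=
      fun i w hw => X_mul_mem_initialForms (Nat.lt_succ_self m) hw
    rw [hprev]
    exact le_stringSpan_of_le_lefschetzSpan hz hsurj

theorem homogeneousComponent_mem_degPart {d : Fin n → ℕ} {f : Fin n → MvPolynomial (Fin n) K}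
    (hf : ∀ j, (f j).IsHomogeneous (d j)) {p : MvPolynomial (Fin n) K}
    (hp : p ∈ Ideal.span (Set.range f)) (t : ℕ) :
    homogeneousComponent t p ∈ degPart f d n t := by
  obtain ⟨c, rfl⟩ := Ideal.mem_span_range_iff_exists_fun.1 hp
  rw [map_sum]
  refine Submodule.sum_mem _ fun j _ => ?_
  rw [(c j).as_sum, Finset.sum_mul, map_sum]
  refine Submodule.sum_mem _ fun α _ => ?_
  have hα : monomial α (coeff α (c j)) = coeff α (c j) • monomial α (1 : K) := by
    rw [smul_monomial, smul_eq_mul, mul_one]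
  rw [hα, smul_mul_assoc, map_smul]
  refine Submodule.smul_mem _ _ ?_
  rw [homogeneousComponent_of_mem (n := expDeg α + d j)
    ((isHomogeneous_monomial (1 : K) rfl).mul (hf j))]
  split_ifs with h
  · exact monomial_mul_mem_degPart f j.2 h.symm
  · exact zero_mem _

theorem mem_degPart_of_isHomogeneous {d : Fin n → ℕ} {f : Fin n → MvPolynomial (Fin n) K}
    (hf : ∀ j, (f j).IsHomogeneous (d j)) {p : MvPolynomial (Fin n) K} {t : ℕ}
    (hp : p ∈ Ideal.span (Set.range f)) (ht : p.IsHomogeneous t) : p ∈ degPart f d n t :=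
  homogeneousComponent_eq_self ht ▸ homogeneousComponent_mem_degPart hf hp t

theorem degPart_le_ideal (f : Fin n → MvPolynomial (Fin n) K) (d : Fin n → ℕ) (r t : ℕ) :
    degPart f d r t ≤ (Ideal.span (Set.range f)).restrictScalars K :=
  degPart_le_iff.2 fun j _ _ _ => Ideal.mul_mem_left _ _ (Ideal.subset_span ⟨j, rfl⟩)

end Specialization

section StandardMonomials

variable {K : Type*} [Field K] {n : ℕ}

theorem formSpan_le_iff {f : Fin n → MvPolynomial (Fin n) K} {s : Set (Fin n × (Fin n →₀ ℕ))}
    {b : Set (Fin n →₀ ℕ)} {S : Submodule K (MvPolynomial (Fin n) K)} :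
    formSpan f s b ≤ S ↔
      (∀ p ∈ s, monomial p.2 (1 : K) * f p.1 ∈ S) ∧ ∀ β ∈ b, monomial β (1 : K) ∈ S := by
  rw [formSpan, Submodule.span_le, Set.union_subset_iff, Set.image_subset_iff,
    Set.image_subset_iff]
  rfl

theorem X_pow_mul_mem_homogeneousSubmodule (j : Fin n) {k i t : ℕ} (hki : k + i = t)
    {w : MvPolynomial (Fin n) K} (hw : w ∈ homogeneousSubmodule (Fin n) K i) :
    X j ^ k * w ∈ homogeneousSubmodule (Fin n) K t := by
  have h := ((isHomogeneous_X K j).pow k).mul hw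
  rwa [one_mul, hki] at h

variable {F : Type*} [Field F] [Algebra F K] {d : Fin n → ℕ} {f : Fin n → MvPolynomial (Fin n) K}
  {last : Fin n} {i k t : ℕ}

/-- Modulo generic forms, multiplication by `x_n^k` is surjective from degree `i` to `k + i` if
`k + i` is at least the degree complementary to `i`. -/
theorem homogeneousSubmodule_le_degPart_sup (hd : ∀ j, 1 ≤ d j) (hf : IsGenericSeq F d f)
    (hlast : (last : ℕ) + 1 = n) (hki : k + i = t) (hk : k + socleDegree d n = 2 * t) :
    homogeneousSubmodule (Fin n) K t ≤
      degPart f d n t ⊔ (homogeneousSubmodule (Fin n) K i).map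
        (LinearMap.mulLeft K (X last ^ k)) := by
  choose g hgh hg using exists_binary_form hf
  let s := {p : Fin n × (Fin n →₀ ℕ) | (p.1 : ℕ) < n ∧ expDeg p.2 + d p.1 = t}
  let b := {β : Fin n →₀ ℕ | expDeg β = t ∧ k ≤ β last}
  have hs : s.Finite := finite_degPart_index d n t
  have hb : b.Finite := (finite_expDeg_eq n t).subset fun _ h => h.1
  have hmul : (homogeneousSubmodule (Fin n) K i).map (LinearMap.mulLeft K (X last ^ k)) ≤
      formSpan g s b := by
    rw [homogeneousSubmodule_eq_span, Submodule.map_span, Submodule.span_le]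
    rintro _ ⟨_, ⟨μ, rfl, rfl⟩, rfl⟩
    refine Submodule.subset_span (.inr ⟨Finsupp.single last k + μ, ⟨?_, ?_⟩, ?_⟩)
    · rw [expDeg_add, expDeg_single, hki]
    · simp
    · rw [LinearMap.mulLeft_apply, X_pow_eq_monomial, monomial_mul, one_mul]
  have hdeg : degPart g d n t ≤ formSpan g s b := degPart_le_iff.2 fun j α hj ht =>
    Submodule.subset_span (.inl ⟨(j, α), ⟨hj, ht⟩, rfl⟩)
  have h1 : homogeneousSubmodule (Fin n) K t ≤ formSpan g s b := by
    intro p hp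
    have hsub := initialForms_le_lefschetzSpan hd hg last k t (by rw [hlast]; exact hk)
    have himg : g '' {j : Fin n | (j : ℕ) < last + 1} = Set.range g := by
      rw [← Set.image_univ]
      congr 1
      ext j
      simp [hlast]
    rw [himg, hlast] at hsub
    obtain ⟨w, hw, hpw⟩ : ∃ w ∈ homogeneousSubmodule (Fin n) K i,
        p - X last ^ k * w ∈ Ideal.span (Set.range g) := by
      rcases mem_lefschetzSpan (hsub (homogeneousSubmodule_le_initialForms t hp)) with h | h
      · exact ⟨0, zero_mem _, by simpa using h⟩
      · obtain ⟨u, w, hw, hu, h⟩ := h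
        obtain rfl : u = i := by omega
        refine ⟨w, ?_, h⟩
        rw [homogeneousSubmodule_eq_span]
        exact Submodule.span_mono (Set.image_mono fun _ h => h.1) hw
    have h := mem_degPart_of_isHomogeneous hgh hpw
      (sub_mem hp (X_pow_mul_mem_homogeneousSubmodule last hki hw))
    simpa using add_mem (hdeg h) (hmul ⟨w, hw, rfl⟩)
  have h2 : formSpan f s b ≤ homogeneousSubmodule (Fin n) K t :=
    formSpan_le_iff.2 ⟨fun p hp => degPart_le_homogeneousSubmodule hf.1 n t
      (monomial_mul_mem_degPart f hp.1 hp.2), fun β hβ => isHomogeneous_monomial _ hβ.1⟩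
  have : FiniteDimensional K (formSpan g s b) :=
    FiniteDimensional.span_of_finite K ((hs.image _).union (hb.image _))
  rw [← Submodule.eq_of_le_of_finrank_le h2
    ((Submodule.finrank_mono h1).trans (finrank_formSpan_le hf hgh hs hb))]
  refine formSpan_le_iff.2 ⟨fun p hp => Submodule.mem_sup_left
    (monomial_mul_mem_degPart f hp.1 hp.2), fun β hβ => Submodule.mem_sup_right
      ⟨monomial (β - Finsupp.single last k) 1, isHomogeneous_monomial _ ?_, ?_⟩⟩
  · have := expDeg_sub (show Finsupp.single last k ≤ β by simpa using hβ.2)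
    rw [expDeg_single, hβ.1] at this
    rw [← expDeg_eq_degree]
    omega
  · rw [LinearMap.mulLeft_apply, X_pow_eq_monomial, monomial_mul, one_mul,
      add_tsub_cancel_of_le (by simpa using hβ.2)]

/-- Modulo generic forms, multiplication by `x_n^k` is injective between complementary degrees. -/
theorem mem_degPart_of_X_pow_mul_mem (hd : ∀ j, 1 ≤ d j) (hf : IsGenericSeq F d f)
    (hlast : (last : ℕ) + 1 = n) (hki : k + i = t) (hit : i + t = socleDegree d n)
    {p : MvPolynomial (Fin n) K} (hp : p ∈ homogeneousSubmodule (Fin n) K i)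
    (hmem : X last ^ k * p ∈ degPart f d n t) : p ∈ degPart f d n i := by
  have hsum := socleDegree_self_add hd
  refine mem_of_map_mem_of_finrank_le (L := LinearMap.mulLeft K (X last ^ k))
    (mul_right_injective₀ (pow_ne_zero _ (X_ne_zero last)))
    (degPart_le_homogeneousSubmodule hf.1 n i) ?_ ?_ hp hmem
  · rintro _ ⟨q, hq, rfl⟩
    have h := mul_mem_degPart ((isHomogeneous_X K last).pow k) hq
    rwa [one_mul, hki] at h
  · have hle := Submodule.finrank_mono
      (homogeneousSubmodule_le_degPart_sup hd hf hlast hki (by omega))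
    have h1 := ncard_boxMonomials_le (d := d) (i := i) (j := t) (by omega)
    rw [finrank_homogeneousSubmodule, ← ncard_powerMultiples_add d n t] at hle
    rw [finrank_degPart hf, finrank_degPart hf, finrank_homogeneousSubmodule,
      ← ncard_powerMultiples_add d n i]
    omega

theorem IsLeadExp.monomial_mul {p : MvPolynomial (Fin n) K} {ν : Fin n →₀ ℕ}
    (h : IsLeadExp p ν) (α : Fin n →₀ ℕ) : IsLeadExp (monomial α (1 : K) * p) (α + ν) := by
  refine ⟨by simpa [coeff_monomial_mul] using mem_support_iff.1 h.1, fun ρ hρ hne => ?_⟩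
  rw [mem_support_iff, coeff_monomial_mul', ite_ne_right_iff, one_mul] at hρ
  obtain ⟨ρ', rfl⟩ := exists_add_of_le hρ.1
  rw [add_tsub_cancel_left] at hρ
  rcases h.2 ρ' (mem_support_iff.2 hρ.2) (fun h => hne (by rw [h])) with h | ⟨h, j, hj, hj'⟩
  · exact .inl (by rw [expDeg_add, expDeg_add]; omega)
  · exact .inr ⟨by rw [expDeg_add, expDeg_add, h], j, by simpa using hj,
      fun l hl => by simp [hj' l hl]⟩

theorem IsLeadExp.homogeneousComponent {p : MvPolynomial (Fin n) K} {μ : Fin n →₀ ℕ}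
    (h : IsLeadExp p μ) : IsLeadExp (homogeneousComponent (expDeg μ) p) μ := by
  have hc : ∀ ν, coeff ν (MvPolynomial.homogeneousComponent (expDeg μ) p) =
      if expDeg ν = expDeg μ then coeff ν p else 0 := fun ν => coeff_homogeneousComponent _ _ _
  refine ⟨?_, fun ν hν hne => h.2 ν ?_ hne⟩
  · rw [mem_support_iff, hc, if_pos rfl]
    exact mem_support_iff.1 h.1
  · rw [mem_support_iff, hc] at hν
    exact mem_support_iff.2 (ite_ne_right_iff.1 hν).2

theorem mem_initialIdeal_of_isLeadExp {I : Ideal (MvPolynomial (Fin n) K)}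
    {p : MvPolynomial (Fin n) K} {μ : Fin n →₀ ℕ} (hp : p ∈ I) (h : IsLeadExp p μ) :
    monomial μ (1 : K) ∈ initialIdeal I :=
  Ideal.subset_span ⟨p, hp, fun h0 => by simp [h0, IsLeadExp] at h, μ, h, rfl⟩

/-- The initial ideal of a homogeneous ideal is spanned by the leading monomials of its forms. -/
theorem exists_isLeadExp_of_mem_initialIdeal (hf : ∀ j, (f j).IsHomogeneous (d j))
    {μ : Fin n →₀ ℕ} (h : monomial μ (1 : K) ∈ initialIdeal (Ideal.span (Set.range f))) :
    ∃ p ∈ degPart f d n (expDeg μ), IsLeadExp p μ := by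
  have hset : {m : MvPolynomial (Fin n) K | ∃ p ∈ Ideal.span (Set.range f), p ≠ 0 ∧
      ∃ μ, IsLeadExp p μ ∧ m = monomial μ (1 : K)} = (fun μ => monomial μ (1 : K)) ''
        {μ | ∃ p ∈ Ideal.span (Set.range f), IsLeadExp p μ} := by
    ext m
    constructor
    · rintro ⟨p, hp, -, ν, hν, rfl⟩
      exact ⟨ν, ⟨p, hp, hν⟩, rfl⟩
    · rintro ⟨ν, ⟨p, hp, hν⟩, rfl⟩
      exact ⟨p, hp, fun h0 => by simp [h0, IsLeadExp] at hν, ν, hν, rfl⟩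
  rw [initialIdeal, hset, mem_ideal_span_monomial_image] at h
  obtain ⟨ν, ⟨p, hp, hν⟩, hle⟩ := h μ (by simp)
  obtain ⟨α, rfl⟩ := exists_add_of_le hle
  rw [add_comm]
  exact ⟨_, homogeneousComponent_mem_degPart hf (Ideal.mul_mem_left _ (monomial α 1) hp) _,
    (hν.monomial_mul α).homogeneousComponent⟩

theorem exists_eq_X_pow_mul (j : Fin n) (k : ℕ) {p : MvPolynomial (Fin n) K}
    (h : ∀ μ ∈ p.support, k ≤ μ j) : ∃ q, p = X j ^ k * q := by
  rw [X_pow_eq_monomial]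
  refine monomial_one_dvd_iff_modMonomial_eq_zero.2 ?_
  ext μ
  by_cases hle : Finsupp.single j k ≤ μ
  · rw [coeff_modMonomial_of_le _ hle, coeff_zero]
  · rw [coeff_modMonomial_of_not_le _ hle, coeff_zero]
    by_contra hne
    exact hle (by simpa using h μ (mem_support_iff.2 hne))

theorem drlLT_of_lt_last (hlast : (last : ℕ) + 1 = n) {μ ν : Fin n →₀ ℕ}
    (h : expDeg ν = expDeg μ) (hlt : μ last < ν last) : DrlLT ν μ :=
  .inr ⟨h, last, hlt, fun j hj => absurd (Fin.lt_def.1 hj) (by omega)⟩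

theorem le_last_of_drlLT (hlast : (last : ℕ) + 1 = n) {μ ν : Fin n →₀ ℕ}
    (h : expDeg ν = expDeg μ) (hlt : DrlLT ν μ) : μ last ≤ ν last := by
  rcases hlt with h' | ⟨-, j, hj, hj'⟩
  · omega
  · rcases Nat.lt_or_ge j last with hl | hl
    · exact (hj' last hl).ge
    · obtain rfl : j = last := Fin.ext (by omega)
      exact hj.le

theorem stdMon_eq_image (hd : ∀ j, 1 ≤ d j) (hf : IsGenericSeq F d f)
    (hlast : (last : ℕ) + 1 = n) (hki : k + i = t) (hit : i + t = socleDegree d n) :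
    stdMon (Ideal.span (Set.range f)) t =
      (fun ν => ν + Finsupp.single last k) '' stdMon (Ideal.span (Set.range f)) i := by
  ext μ
  constructor
  · rintro ⟨rfl, hμ⟩
    have hk : k ≤ μ last := by
      by_contra! hlt
      obtain ⟨p, hp, _, ⟨q, hq, rfl⟩, hpq⟩ := Submodule.mem_sup.1
        (homogeneousSubmodule_le_degPart_sup hd hf hlast hki (by omega)
          (isHomogeneous_monomial (1 : K) rfl : monomial μ (1 : K) ∈
            homogeneousSubmodule (Fin n) K (expDeg μ)))
      rw [LinearMap.mulLeft_apply] at hpq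
      have hcoeff : ∀ ν : Fin n →₀ ℕ, ν last < k → coeff ν p = if μ = ν then 1 else 0 := by
        intro ν hν
        have hle : ¬Finsupp.single last k ≤ ν := by simpa using hν
        rw [eq_sub_of_add_eq hpq, coeff_sub, coeff_monomial, X_pow_eq_monomial,
          coeff_monomial_mul', if_neg hle, sub_zero]
      refine hμ (mem_initialIdeal_of_isLeadExp (degPart_le_ideal f d n _ hp)
        ⟨mem_support_iff.2 (by rw [hcoeff μ hlt, if_pos rfl]; exact one_ne_zero),
          fun ν hν hne => drlLT_of_lt_last hlast ?_ ?_⟩)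
      · by_contra hdeg
        exact mem_support_iff.1 hν (IsHomogeneous.coeff_eq_zero
          (degPart_le_homogeneousSubmodule hf.1 n _ hp) hdeg)
      · refine hlt.trans_le (not_lt.1 fun hνk => mem_support_iff.1 hν ?_)
        rw [hcoeff ν hνk, if_neg (Ne.symm hne)]
    have hle : Finsupp.single last k ≤ μ := by simpa using hk
    refine ⟨μ - Finsupp.single last k, ⟨?_, fun h => hμ ?_⟩, tsub_add_cancel_of_le hle⟩
    · have := expDeg_sub hle
      rw [expDeg_single] at this
      omega
    · have := Ideal.mul_mem_left _ (monomial (Finsupp.single last k) (1 : K)) h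
      rwa [MvPolynomial.monomial_mul, one_mul, add_tsub_cancel_of_le hle] at this
  · rintro ⟨ν, ⟨rfl, hν⟩, rfl⟩
    have hdeg : expDeg (ν + Finsupp.single last k) = t := by
      rw [expDeg_add, expDeg_single]; omega
    refine ⟨hdeg, fun h => hν ?_⟩
    obtain ⟨p, hp, hlead⟩ := exists_isLeadExp_of_mem_initialIdeal hf.1 h
    dsimp only at hp hlead
    rw [hdeg] at hp
    have hpt := degPart_le_homogeneousSubmodule hf.1 n t hp
    have hsupp : ∀ ρ ∈ p.support, expDeg ρ = t := fun ρ hρ => by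
      by_contra hne
      exact mem_support_iff.1 hρ (IsHomogeneous.coeff_eq_zero hpt hne)
    obtain ⟨q, rfl⟩ := exists_eq_X_pow_mul last k (p := p) fun ρ hρ => by
      have hk : k ≤ (ν + Finsupp.single last k) last := by simp
      rcases eq_or_ne ρ (ν + Finsupp.single last k) with rfl | hne
      · exact hk
      · exact hk.trans (le_last_of_drlLT hlast (by rw [hsupp ρ hρ, hdeg]) (hlead.2 ρ hρ hne))
    have hco : ∀ ρ, coeff (ρ + Finsupp.single last k) (X last ^ k * q) = coeff ρ q := fun ρ => by
      rw [X_pow_eq_monomial, add_comm, coeff_monomial_mul, one_mul]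
    have hq : q ∈ homogeneousSubmodule (Fin n) K (expDeg ν) := by
      intro ρ hρ
      have := hsupp (ρ + Finsupp.single last k) (mem_support_iff.2 (by rwa [hco]))
      rw [expDeg_add, expDeg_single] at this
      have hw : Finsupp.weight 1 ρ = expDeg ρ := by
        rw [expDeg_eq_degree, Finsupp.degree_eq_weight_one]
        rfl
      rw [hw]
      omega
    refine mem_initialIdeal_of_isLeadExp (degPart_le_ideal f d n _
      (mem_degPart_of_X_pow_mul_mem hd hf hlast hki hit hq hp))
      ⟨mem_support_iff.2 ?_, fun ρ hρ hne => ?_⟩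
    · rw [← hco]
      exact mem_support_iff.1 hlead.1
    · have h1 := hlead.2 (ρ + Finsupp.single last k)
        (mem_support_iff.2 (by rw [hco]; exact mem_support_iff.1 hρ))
        fun h => hne (add_right_cancel h)
      rcases h1 with h1 | ⟨h1, j, hj, hj'⟩
      · exact .inl (by rw [expDeg_add, expDeg_add] at h1; omega)
      · exact .inr ⟨by rw [expDeg_add, expDeg_add] at h1; omega, j, by simpa using hj,
          fun l hl => by simpa using hj' l hl⟩

end StandardMonomials

/-- for `0 ≤ i ≤ σ`, `B_{δ−i} = x_n^{δ−2i}·B_i`. -/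
theorem stmt3 {F K : Type*} [Field F] [Field K] [Algebra F K] [Infinite K]
    {n : ℕ} (hn : 0 < n) (d : Fin n → ℕ) (hd : ∀ i, 1 ≤ d i)
    (f : Fin n → MvPolynomial (Fin n) K) (hf : IsGenericSeq F d f)
    (J : Ideal (MvPolynomial (Fin n) K)) (hJ : J = Ideal.span (Set.range f))
    (δ δs σ : ℕ) (hδ : δ = (∑ j, d j) - n)
    (hδs : δs = (∑ j ∈ Finset.univ.filter (fun j : Fin n => (j : ℕ) < n - 1), d j) - (n - 1))
    (hσ : σ = min δs (δ / 2))
    (i : ℕ) (hi : i ≤ σ) :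
    stdMon J (δ - i) =
      (fun ν => ν + Finsupp.single (⟨n - 1, by omega⟩ : Fin n) (δ - 2 * i)) '' stdMon J i := by
  have hsum := socleDegree_self_add hd
  subst hJ
  exact stdMon_eq_image hd hf (Nat.sub_add_cancel hn) (by omega) (by omega)
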